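/- arXiv:2504.17322 — 3 statements merged into one kernel-verified Lean document; each statement's English description precedes it below -/
import Mathlib

section
/- Let f : ℝ × ℝ × ℝ → ℝ be a measurable, nonnegative, Lebesgue-integrable joint density with f(x,y,z) > 0 for all (x,y,z), and suppose all four marginals f_Y, f_Z, f_{YZ}, f_{XZ} are finite and positive everywhere. Let φ_X, φ_Y, φ_Z : ℝ → ℝ be strictly monotone continuously differentiable bijections whose derivatives never vanish. Define the transformed density f̃(x̃,ỹ,z̃) := f(φ_X⁻¹(x̃), φ_Y⁻¹(ỹ), φ_Z⁻¹(z̃)) / (|φ_X'(φ_X⁻¹(x̃))| · |φ_Y'(φ_Y⁻¹(ỹ))| · |φ_Z'(φ_Z⁻¹(z̃))|), define its marginals f̃_Y, f̃_Z, f̃_{YZ}, f̃_{XZ} by integrating f̃ in the remaining variables, and define r̃_0 and π̃_0 from f̃ by the same formulas as r_0 and π_0 are defined from f. Then the (possibly infinite) Lebesgue integrals of the nonnegative integrands agree: ∫∫∫ (1 − π̃_0(x̃,ỹ,z̃))² r̃_0(ỹ,z̃) f̃(x̃,ỹ,z̃) dx̃ dỹ dz̃ = ∫∫∫ (1 − π_0(x,y,z))²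 r_0(y,z) f(x,y,z) dx dy dz. That is, the conditional-independence functional I_0 is invariant under componentwise monotone transformations of the data. -/
open MeasureTheory

/-- Marginal density of `Y`: `f_Y(y) = ∫∫ f(x,y,z) dx dz` (as a possibly infinite
Lebesgue integral of the nonnegative integrand). -/
noncomputable def margY (f : ℝ × ℝ × ℝ → ℝ) (y : ℝ) : ENNReal :=
  ∫⁻ q : ℝ × ℝ, ENNReal.ofReal (f (q.1, y, q.2))

/-- Marginal density of `Z`: `f_Z(z) = ∫∫ f(x,y,z) dx dy`. -/
noncomputable def margZ (f : ℝ × ℝ × ℝ → ℝ) (z : ℝ) : ENNReal :=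
  ∫⁻ q : ℝ × ℝ, ENNReal.ofReal (f (q.1, q.2, z))

/-- Marginal density of `(Y,Z)`: `f_{YZ}(y,z) = ∫ f(x,y,z) dx`. -/
noncomputable def margYZ (f : ℝ × ℝ × ℝ → ℝ) (y z : ℝ) : ENNReal :=
  ∫⁻ x : ℝ, ENNReal.ofReal (f (x, y, z))

/-- Marginal density of `(X,Z)`: `f_{XZ}(x,z) = ∫ f(x,y,z) dy`. -/
noncomputable def margXZ (f : ℝ × ℝ × ℝ → ℝ) (x z : ℝ) : ENNReal :=
  ∫⁻ y : ℝ, ENNReal.ofReal (f (x, y, z))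

/-- Unconditional density ratio `r₀(y,z) = f_Y(y) f_Z(z) / f_{YZ}(y,z)`. -/
noncomputable def r0 (f : ℝ × ℝ × ℝ → ℝ) (y z : ℝ) : ℝ :=
  (margY f y).toReal * (margZ f z).toReal / (margYZ f y z).toReal

/-- Conditional density ratio
`π₀(x,y,z) = f_{XZ}(x,z) f_{YZ}(y,z) / (f_Z(z) f(x,y,z))`. -/
noncomputable def pi0 (f : ℝ × ℝ × ℝ → ℝ) (x y z : ℝ) : ℝ :=
  (margXZ f x z).toReal * (margYZ f y z).toReal / ((margZ f z).toReal * f (x, y, z))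

/-- The conditional-independence functional
`I₀ = ∫∫∫ (1 − π₀(x,y,z))² r₀(y,z) f(x,y,z) dx dy dz`, as a possibly infinite
Lebesgue integral of the nonnegative integrand. -/
noncomputable def I0fun (f : ℝ × ℝ × ℝ → ℝ) : ENNReal :=
  ∫⁻ p : ℝ × ℝ × ℝ,
    ENNReal.ofReal ((1 - pi0 f p.1 p.2.1 p.2.2) ^ 2 * r0 f p.2.1 p.2.2 * f p)

/-- A change of variables with Jacobian weight `w`. -/
structure CoV {α : Type*} [MeasureSpace α] (φ : α → α) (w : α → ℝ) : Prop where
  emb : MeasurableEmbedding φ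
  meas : Measurable w
  nonneg : ∀ x, 0 ≤ w x
  mp : MeasurePreserving φ (volume.withDensity fun x => ENNReal.ofReal (w x)) volume

lemma CoV.lint {α : Type*} [MeasureSpace α] {φ : α → α} {w : α → ℝ} (h : CoV φ w)
    (g : α → ENNReal) : ∫⁻ y, g y = ∫⁻ x, ENNReal.ofReal (w x) * g (φ x) := by
  rw [← h.mp.lintegral_comp_emb h.emb g,
    lintegral_withDensity_eq_lintegral_mul_non_measurable _ h.meas.ennreal_ofReal
      (Filter.Eventually.of_forall fun x => ENNReal.ofReal_lt_top)]
  rfl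

lemma CoV.prod {α β : Type*} [MeasureSpace α] [MeasureSpace β]
    [SigmaFinite (volume : Measure α)] [SigmaFinite (volume : Measure β)]
    {φ : α → α} {w : α → ℝ} {ψ : β → β} {v : β → ℝ} (h : CoV φ w) (k : CoV ψ v) :
    CoV (Prod.map φ ψ) (fun p => w p.1 * v p.2) where
  emb := h.emb.prodMap k.emb
  meas := (h.meas.comp measurable_fst).mul (k.meas.comp measurable_snd)
  nonneg p := mul_nonneg (h.nonneg _) (k.nonneg _)
  mp := by
    have := h.mp.prod k.mp
    rw [prod_withDensity h.meas.ennreal_ofReal k.meas.ennreal_ofReal] at this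
    simp only [ENNReal.ofReal_mul (h.nonneg _)]
    exact this

lemma cov_real {φ d : ℝ → ℝ} (hb : Function.Bijective φ) (hd : ∀ x, HasDerivAt φ (d x) x)
    (hc : Continuous d) : CoV φ (fun x => |d x|) := by
  have hcont : Continuous φ := continuous_iff_continuousAt.2 fun x => (hd x).continuousAt
  have hemb := hcont.measurableEmbedding hb.injective
  refine ⟨hemb, hc.abs.measurable, fun x => abs_nonneg _, hemb.measurable, ?_⟩
  ext s hs
  rw [hemb.map_apply, withDensity_apply _ (hemb.measurable hs)]
  have := lintegral_abs_det_fderiv_eq_addHaar_image (volume : Measure ℝ)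
    (hemb.measurable hs) (fun x _ => (hd x).hasFDerivAt.hasFDerivWithinAt) (hb.injective.injOn)
  rw [Set.image_preimage_eq _ hb.surjective] at this
  rw [← this]
  simp

lemma cov_lint_mul {α : Type*} [MeasureSpace α] {φ : α → α} {w : α → ℝ} (h : CoV φ w)
    (hw : ∀ x, w x ≠ 0) (g g' : α → ℝ) (c : ℝ) (hc : 0 ≤ c)
    (hg : ∀ x, g (φ x) = g' x / (w x * c)) :
    (∫⁻ y, ENNReal.ofReal (g y)).toReal = (∫⁻ y, ENNReal.ofReal (g' y)).toReal / c := by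
  rw [h.lint]
  have : ∀ x, ENNReal.ofReal (w x) * ENNReal.ofReal (g (φ x))
      = ENNReal.ofReal c⁻¹ * ENNReal.ofReal (g' x) := by
    intro x
    rw [← ENNReal.ofReal_mul (h.nonneg x), ← ENNReal.ofReal_mul (inv_nonneg.2 hc), hg]
    congr 1
    have := hw x
    rw [div_eq_mul_inv, mul_inv]
    field_simp
  simp only [this]
  rw [lintegral_const_mul' _ _ ENNReal.ofReal_ne_top, ENNReal.toReal_mul,
    ENNReal.toReal_ofReal (inv_nonneg.2 hc)]
  ring

/-- invariance of the conditional-independence functional `I₀` under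
componentwise strictly monotone continuously differentiable transformations of the data. -/
theorem I0_invariant_under_monotone_transformations
    (f : ℝ × ℝ × ℝ → ℝ)
    (hf_meas : Measurable f) (hf_nonneg : ∀ p, 0 ≤ f p) (hf_int : Integrable f)
    (hf_pos : ∀ p, 0 < f p)
    (hY : ∀ y, 0 < margY f y ∧ margY f y < ⊤)
    (hZ : ∀ z, 0 < margZ f z ∧ margZ f z < ⊤)
    (hYZ : ∀ y z, 0 < margYZ f y z ∧ margYZ f y z < ⊤)
    (hXZ : ∀ x z, 0 < margXZ f x z ∧ margXZ f x z < ⊤)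
    (φX φY φZ dX dY dZ : ℝ → ℝ)
    (hbX : Function.Bijective φX) (hbY : Function.Bijective φY) (hbZ : Function.Bijective φZ)
    (hmX : StrictMono φX ∨ StrictAnti φX)
    (hmY : StrictMono φY ∨ StrictAnti φY)
    (hmZ : StrictMono φZ ∨ StrictAnti φZ)
    (hdX : ∀ x, HasDerivAt φX (dX x) x) (hdXc : Continuous dX) (hdX0 : ∀ x, dX x ≠ 0)
    (hdY : ∀ y, HasDerivAt φY (dY y) y) (hdYc : Continuous dY) (hdY0 : ∀ y, dY y ≠ 0)
    (hdZ : ∀ z, HasDerivAt φZ (dZ z) z) (hdZc : Continuous dZ) (hdZ0 : ∀ z, dZ z ≠ 0)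
    (ftil : ℝ × ℝ × ℝ → ℝ)
    (hftil : ∀ p : ℝ × ℝ × ℝ,
      ftil p =
        f (Function.invFun φX p.1, Function.invFun φY p.2.1, Function.invFun φZ p.2.2) /
          (|dX (Function.invFun φX p.1)| * |dY (Function.invFun φY p.2.1)| *
            |dZ (Function.invFun φZ p.2.2)|)) :
    I0fun ftil = I0fun f := by
  have cX := cov_real hbX hdX hdXc
  have cY := cov_real hbY hdY hdYc
  have cZ := cov_real hbZ hdZ hdZc
  have aX : ∀ x, 0 < |dX x| := fun x => abs_pos.2 (hdX0 x)
  have aY : ∀ x, 0 < |dY x| := fun x => abs_pos.2 (hdY0 x)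
  have aZ : ∀ x, 0 < |dZ x| := fun x => abs_pos.2 (hdZ0 x)
  have hft : ∀ x y z, ftil (φX x, φY y, φZ z) = f (x, y, z) / (|dX x| * |dY y| * |dZ z|) := by
    intro x y z
    rw [hftil]
    simp only [Function.leftInverse_invFun hbX.injective x,
      Function.leftInverse_invFun hbY.injective y, Function.leftInverse_invFun hbZ.injective z]
  have eY : ∀ y, (margY ftil (φY y)).toReal = (margY f y).toReal / |dY y| := by
    intro y
    refine cov_lint_mul (cX.prod cZ) (fun q => (mul_pos (aX _) (aZ _)).ne') _ _ _
      (aY y).le (fun q => ?_)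
    simp only [Prod.map, hft]
    congr 1
    ring
  have eZ : ∀ z, (margZ ftil (φZ z)).toReal = (margZ f z).toReal / |dZ z| := by
    intro z
    refine cov_lint_mul (cX.prod cY) (fun q => (mul_pos (aX _) (aY _)).ne') _ _ _
      (aZ z).le (fun q => ?_)
    simp only [Prod.map, hft]
  have eYZ : ∀ y z, (margYZ ftil (φY y) (φZ z)).toReal
      = (margYZ f y z).toReal / (|dY y| * |dZ z|) := by
    intro y z
    refine cov_lint_mul cX (fun q => (aX _).ne') _ _ _
      (mul_pos (aY y) (aZ z)).le (fun q => ?_)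
    simp only [hft]
    congr 1
    ring
  have eXZ : ∀ x z, (margXZ ftil (φX x) (φZ z)).toReal
      = (margXZ f x z).toReal / (|dX x| * |dZ z|) := by
    intro x z
    refine cov_lint_mul cY (fun q => (aY _).ne') _ _ _
      (mul_pos (aX x) (aZ z)).le (fun q => ?_)
    simp only [hft]
    congr 1
    ring
  unfold I0fun
  rw [(cX.prod (cY.prod cZ)).lint]
  refine lintegral_congr fun p => ?_
  obtain ⟨x, y, z⟩ := p
  have hx := aX x
  have hy := aY y
  have hz := aZ z
  have hpi : pi0 ftil (φX x) (φY y) (φZ z) = pi0 f x y z := by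
    have h1 := ENNReal.toReal_pos (hZ z).1.ne' (hZ z).2.ne
    have h2 := hf_pos (x, y, z)
    simp only [pi0, eXZ, eYZ, eZ, hft]
    field_simp
  have hr : r0 ftil (φY y) (φZ z) = r0 f y z := by
    have h1 := ENNReal.toReal_pos (hYZ y z).1.ne' (hYZ y z).2.ne
    simp only [r0, eY, eYZ, eZ]
    field_simp
  simp only [Prod.map, hpi, hr, hft]
  rw [← ENNReal.ofReal_mul (by positivity)]
  congr 1
  field_simp
end

section
/- Let n ≥ 2, K₀ ≥ 1, K ≥ 1 be integers and let (X_t, Y_t, Z_t) ∈ ℝ^a × ℝ^b × ℝ^c for t = 1,…,n. Let u : ℝ^b × ℝ^c → ℝ^{K₀} and v : ℝ^a × ℝ^b × ℝ^c → ℝ^K be functions such that there is a K₀ × K real matrix A with A · v(x,y,z) = u(y,z) for all (x,y,z) (i.e. the span of the components of u, viewed as functions of (x,y,z), is contained in the span of the components of v). With Σ̂ := (1/n) Σ_t u(Y_t,Z_t)u(Y_t,Z_t)⊤, b̂ := (1/(n(n−1))) Σ_{i≠j} u(Y_i,Z_j), γ̂ := Σ̂⁻¹ b̂, r̂ := γ̂⊤u,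 Ĥ := (1/n) Σ_t r̂(Y_t,Z_t) v(X_t,Y_t,Z_t)v(X_t,Y_t,Z_t)⊤, ĥ := (1/(n(n−1))) Σ_{i≠j} v(X_i,Y_j,Z_i), β̂ := Ĥ⁻¹ ĥ, π̂ := β̂⊤v (assuming Σ̂ and Ĥ invertible), the three-way balancing empirical moments hold: (1/n) Σ_{t=1}^n π̂(X_t,Y_t,Z_t) r̂(Y_t,Z_t) u(Y_t,Z_t) = (1/(n(n−1))) Σ_{i≠j} u(Y_i,Z_j) = (1/n) Σ_{t=1}^n r̂(Y_t,Z_t) u(Y_t,Z_t). -/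
open Matrix

/-- A weighted Gram matrix applied to a coefficient vector. -/
lemma gram_mulVec_aux {n K : ℕ} (c : ℝ) (w : Fin n → ℝ) (f : Fin n → Fin K → ℝ)
    (g : Fin K → ℝ) (k : Fin K) :
    (Matrix.mulVec (fun i j => c * ∑ t, w t * f t i * f t j : Matrix (Fin K) (Fin K) ℝ) g) k
      = c * ∑ t, (g ⬝ᵥ f t) * w t * f t k := by
  simp only [Matrix.mulVec, dotProduct, Finset.mul_sum, Finset.sum_mul]
  rw [Finset.sum_comm]
  refine Finset.sum_congr rfl fun t _ => Finset.sum_congr rfl fun l _ => ?_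
  ring

/-- three-way balancing. When the span of the first-stage basis `u` (viewed
as functions of `(x,y,z)`) is contained in the span of the second-stage basis `v`
(witnessed by a matrix `A` with `A v(x,y,z) = u(y,z)`), the two-stage sieve least-squares
estimators `r̂` and `π̂` satisfy
`(1/n)Σ_t π̂ r̂ u(Y_t,Z_t) = (1/(n(n−1)))Σ_{i≠j} u(Y_i,Z_j) = (1/n)Σ_t r̂ u(Y_t,Z_t)`. -/
theorem three_way_balancing
    (n K₀ K a b c : ℕ) (hn : 2 ≤ n) (hK₀ : 1 ≤ K₀) (hK : 1 ≤ K)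
    (X : Fin n → Fin a → ℝ) (Y : Fin n → Fin b → ℝ) (Z : Fin n → Fin c → ℝ)
    (u : (Fin b → ℝ) × (Fin c → ℝ) → Fin K₀ → ℝ)
    (v : (Fin a → ℝ) × (Fin b → ℝ) × (Fin c → ℝ) → Fin K → ℝ)
    (A : Matrix (Fin K₀) (Fin K) ℝ)
    (hA : ∀ (x : Fin a → ℝ) (y : Fin b → ℝ) (z : Fin c → ℝ),
      A.mulVec (v (x, y, z)) = u (y, z))
    (Sighat : Matrix (Fin K₀) (Fin K₀) ℝ)
    (hSig : Sighat = fun i j => (1 / (n : ℝ)) * ∑ t, u (Y t, Z t) i * u (Y t, Z t) j)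
    (bhat : Fin K₀ → ℝ)
    (hb : bhat = fun k => (1 / ((n : ℝ) * ((n : ℝ) - 1))) *
      ∑ i, ∑ j, if j = i then 0 else u (Y i, Z j) k)
    (hSig_inv : IsUnit Sighat.det)
    (γhat : Fin K₀ → ℝ) (hγ : γhat = Sighat⁻¹.mulVec bhat)
    (rhat : (Fin b → ℝ) × (Fin c → ℝ) → ℝ) (hr : rhat = fun q => γhat ⬝ᵥ u q)
    (Hhat : Matrix (Fin K) (Fin K) ℝ)
    (hH : Hhat = fun i j => (1 / (n : ℝ)) *
      ∑ t, rhat (Y t, Z t) * v (X t, Y t, Z t) i * v (X t, Y t, Z t) j)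
    (hhat : Fin K → ℝ)
    (hh : hhat = fun k => (1 / ((n : ℝ) * ((n : ℝ) - 1))) *
      ∑ i, ∑ j, if j = i then 0 else v (X i, Y j, Z i) k)
    (hH_inv : IsUnit Hhat.det)
    (βhat : Fin K → ℝ) (hβ : βhat = Hhat⁻¹.mulVec hhat)
    (πhat : (Fin a → ℝ) × (Fin b → ℝ) × (Fin c → ℝ) → ℝ)
    (hπ : πhat = fun p => βhat ⬝ᵥ v p) :
    ∀ k, (1 / (n : ℝ)) *
        (∑ t, πhat (X t, Y t, Z t) * rhat (Y t, Z t) * u (Y t, Z t) k) = bhat k ∧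
      bhat k = (1 / (n : ℝ)) * ∑ t, rhat (Y t, Z t) * u (Y t, Z t) k := by
  have h1 : ∀ k, bhat k = (1 / (n : ℝ)) * ∑ t, rhat (Y t, Z t) * u (Y t, Z t) k := by
    intro k
    have e : Sighat.mulVec γhat = bhat := by
      rw [hγ, Matrix.mulVec_mulVec, Matrix.mul_nonsing_inv _ hSig_inv, Matrix.one_mulVec]
    have g := gram_mulVec_aux (1 / (n : ℝ)) (fun _ => 1) (fun t => u (Y t, Z t)) γhat k
    simp only [one_mul, mul_one] at g
    rw [← hSig, e] at g
    rw [g, hr]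
  have h2 : ∀ l, hhat l = (1 / (n : ℝ)) *
      ∑ t, πhat (X t, Y t, Z t) * rhat (Y t, Z t) * v (X t, Y t, Z t) l := by
    intro l
    have e : Hhat.mulVec βhat = hhat := by
      rw [hβ, Matrix.mulVec_mulVec, Matrix.mul_nonsing_inv _ hH_inv, Matrix.one_mulVec]
    have g := gram_mulVec_aux (1 / (n : ℝ)) (fun t => rhat (Y t, Z t))
      (fun t => v (X t, Y t, Z t)) βhat l
    rw [← hH, e] at g
    rw [g, hπ]
  have hu : ∀ x y z k, u (y, z) k = ∑ l, A k l * v (x, y, z) l := by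
    intro x y z k
    rw [← hA x y z]
    rfl
  intro k
  refine ⟨?_, h1 k⟩
  have h3 : ∑ l, A k l * hhat l = bhat k := by
    rw [hh, hb]
    have e : ∀ i j, (if j = i then 0 else u (Y i, Z j) k)
        = ∑ l, A k l * (if i = j then 0 else v (X j, Y i, Z j) l) := by
      intro i j
      by_cases h : j = i
      · simp [h]
      · simp only [if_neg h, if_neg (Ne.symm h)]
        exact hu _ _ _ _
    simp only [e]
    rw [Finset.sum_comm (s := Finset.univ (α := Fin n))]
    simp only [Finset.mul_sum]
    rw [Finset.sum_comm]
    refine Finset.sum_congr rfl fun i _ => ?_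
    rw [Finset.sum_comm]
    refine Finset.sum_congr rfl fun j _ => Finset.sum_congr rfl fun l _ => ?_
    ring
  rw [← h3]
  simp only [h2, Finset.mul_sum]
  rw [Finset.sum_comm]
  refine Finset.sum_congr rfl fun t _ => ?_
  rw [hu (X t), Finset.mul_sum, Finset.mul_sum]
  refine Finset.sum_congr rfl fun l _ => ?_
  ring
end

section
/- Let n ≥ 2, K₀ ≥ 1, K ≥ 1 be integers, let (X_t, Y_t, Z_t) ∈ ℝ^a × ℝ^b × ℝ^c for t = 1,…,n, and let u : ℝ^b × ℝ^c → ℝ^{K₀} and v : ℝ^a × ℝ^b × ℝ^c → ℝ^K be functions whose component spans contain the constants: there exist a ∈ ℝ^{K₀} with a⊤u(y,z) = 1 for all (y,z) and c ∈ ℝ^K with c⊤v(x,y,z) = 1 for all (x,y,z). Define Σ̂, b̂, γ̂, r̂, Ĥ, ĥ, β̂, π̂ as in the two-stage sieve least-squares construction (assuming Σ̂ and Ĥ invertible). Then the test statistic admits the closed form (1/(2n)) Σ_{t=1}^n (π̂(X_t,Y_t,Z_t) − 1)² r̂(Y_t,Z_t) = (1/(2n)) Σ_{t=1}^n π̂(X_t,Y_t,Z_t)²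 r̂(Y_t,Z_t) − 1/2. -/
open Matrix

/-- Abstract moment restriction: testing the normal equations against the constant function. -/
theorem moment_aux (n K : ℕ) (hn : 2 ≤ n) (w : Fin n → ℝ) (V : Fin n → Fin K → ℝ)
    (W : Fin n → Fin n → Fin K → ℝ) (c0 : Fin K → ℝ)
    (hV : ∀ t, c0 ⬝ᵥ V t = 1) (hW : ∀ i j, c0 ⬝ᵥ W i j = 1)
    (H : Matrix (Fin K) (Fin K) ℝ)
    (hH : H = fun i j => (1 / (n : ℝ)) * ∑ t, w t * V t i * V t j)
    (h : Fin K → ℝ)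
    (hh : h = fun k => (1 / ((n : ℝ) * ((n : ℝ) - 1))) *
      ∑ i, ∑ j, if j = i then 0 else W i j k)
    (hinv : IsUnit H.det) (β : Fin K → ℝ) (hβ : β = H⁻¹.mulVec h) :
    (1 / (n : ℝ)) * ∑ t, (β ⬝ᵥ V t) * w t = 1 := by
  have hn' : (2 : ℝ) ≤ n := by exact_mod_cast hn
  have h1 : H *ᵥ β = h := by
    rw [hβ, Matrix.mulVec_mulVec, Matrix.mul_nonsing_inv _ hinv, Matrix.one_mulVec]
  have h2 : H = (1 / (n : ℝ)) • ∑ t, w t • Matrix.vecMulVec (V t) (V t) := by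
    ext i j
    simp [hH, Matrix.sum_apply, Matrix.vecMulVec_apply, mul_assoc]
  have h3 : h = (1 / ((n : ℝ) * ((n : ℝ) - 1))) • ∑ i, ∑ j, if j = i then 0 else W i j := by
    ext k
    simp only [hh, Pi.smul_apply, Finset.sum_apply, smul_eq_mul]
    congr 1
    refine Finset.sum_congr rfl fun i _ => Finset.sum_congr rfl fun j _ => ?_
    split_ifs <;> rfl
  have h4 : c0 ⬝ᵥ h = 1 := by
    have e : ∀ i j : Fin n, c0 ⬝ᵥ (if j = i then 0 else W i j) = 1 - if j = i then 1 else 0 := by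
      intro i j
      split_ifs <;> simp [hW]
    rw [h3, dotProduct_smul, dotProduct_sum]
    simp only [dotProduct_sum, e, Finset.sum_sub_distrib]
    simp
    have : (n : ℝ) ≠ 0 := by linarith
    have : (n : ℝ) - 1 ≠ 0 := by linarith
    field_simp
  have h5 : c0 ⬝ᵥ (H *ᵥ β) = (1 / (n : ℝ)) * ∑ t, (β ⬝ᵥ V t) * w t := by
    rw [h2, Matrix.smul_mulVec, Matrix.sum_mulVec, dotProduct_smul, dotProduct_sum, smul_eq_mul]
    congr 1
    refine Finset.sum_congr rfl fun t _ => ?_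
    rw [Matrix.smul_mulVec, Matrix.vecMulVec_mulVec, dotProduct_smul, dotProduct_smul, hV t,
      dotProduct_comm β]
    simp [mul_comm]
  rw [← h5, h1, h4]

/-- when the spans of both sieve bases contain the constant function 1,
the conditional density ratio test statistic admits the closed form
`(1/(2n))Σ_t (π̂ − 1)² r̂ = (1/(2n))Σ_t π̂² r̂ − 1/2`. -/
theorem test_statistic_closed_form
    (n K₀ K a b c : ℕ) (hn : 2 ≤ n) (hK₀ : 1 ≤ K₀) (hK : 1 ≤ K)
    (X : Fin n → Fin a → ℝ) (Y : Fin n → Fin b → ℝ) (Z : Fin n → Fin c → ℝ)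
    (u : (Fin b → ℝ) × (Fin c → ℝ) → Fin K₀ → ℝ)
    (v : (Fin a → ℝ) × (Fin b → ℝ) × (Fin c → ℝ) → Fin K → ℝ)
    (hu_const : ∃ a0 : Fin K₀ → ℝ, ∀ q : (Fin b → ℝ) × (Fin c → ℝ), a0 ⬝ᵥ u q = 1)
    (hv_const : ∃ c0 : Fin K → ℝ,
      ∀ p : (Fin a → ℝ) × (Fin b → ℝ) × (Fin c → ℝ), c0 ⬝ᵥ v p = 1)
    (Sighat : Matrix (Fin K₀) (Fin K₀) ℝ)
    (hSig : Sighat = fun i j => (1 / (n : ℝ)) * ∑ t, u (Y t, Z t) i * u (Y t, Z t) j)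
    (bhat : Fin K₀ → ℝ)
    (hb : bhat = fun k => (1 / ((n : ℝ) * ((n : ℝ) - 1))) *
      ∑ i, ∑ j, if j = i then 0 else u (Y i, Z j) k)
    (hSig_inv : IsUnit Sighat.det)
    (γhat : Fin K₀ → ℝ) (hγ : γhat = Sighat⁻¹.mulVec bhat)
    (rhat : (Fin b → ℝ) × (Fin c → ℝ) → ℝ) (hr : rhat = fun q => γhat ⬝ᵥ u q)
    (Hhat : Matrix (Fin K) (Fin K) ℝ)
    (hH : Hhat = fun i j => (1 / (n : ℝ)) *
      ∑ t, rhat (Y t, Z t) * v (X t, Y t, Z t) i * v (X t, Y t, Z t) j)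
    (hhat : Fin K → ℝ)
    (hh : hhat = fun k => (1 / ((n : ℝ) * ((n : ℝ) - 1))) *
      ∑ i, ∑ j, if j = i then 0 else v (X i, Y j, Z i) k)
    (hH_inv : IsUnit Hhat.det)
    (βhat : Fin K → ℝ) (hβ : βhat = Hhat⁻¹.mulVec hhat)
    (πhat : (Fin a → ℝ) × (Fin b → ℝ) × (Fin c → ℝ) → ℝ)
    (hπ : πhat = fun p => βhat ⬝ᵥ v p) :
    (1 / (2 * (n : ℝ))) * ∑ t, (πhat (X t, Y t, Z t) - 1) ^ 2 * rhat (Y t, Z t)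
      = (1 / (2 * (n : ℝ))) * ∑ t, (πhat (X t, Y t, Z t)) ^ 2 * rhat (Y t, Z t) - 1 / 2 := by
  have hn' : (2 : ℝ) ≤ n := by exact_mod_cast hn
  have hn0 : (n : ℝ) ≠ 0 := by linarith
  obtain ⟨a0, ha0⟩ := hu_const
  obtain ⟨c0, hc0⟩ := hv_const
  have A := moment_aux n K₀ hn (fun _ => 1) (fun t => u (Y t, Z t)) (fun i j => u (Y i, Z j)) a0
    (fun _ => ha0 _) (fun _ _ => ha0 _) Sighat (by simpa using hSig) bhat hb hSig_inv γhat hγ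
  have B := moment_aux n K hn (fun t => rhat (Y t, Z t)) (fun t => v (X t, Y t, Z t))
    (fun i j => v (X i, Y j, Z i)) c0
    (fun _ => hc0 _) (fun _ _ => hc0 _) Hhat hH hhat hh hH_inv βhat hβ
  have A' : ∑ t, rhat (Y t, Z t) = n := by
    simp only [mul_one] at A
    rw [hr]
    field_simp at A
    exact A
  have B' : ∑ t, πhat (X t, Y t, Z t) * rhat (Y t, Z t) = n := by
    rw [hπ]
    field_simp at B
    exact B
  have E : ∑ t, (πhat (X t, Y t, Z t) - 1) ^ 2 * rhat (Y t, Z t)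
      = ∑ t, (πhat (X t, Y t, Z t)) ^ 2 * rhat (Y t, Z t)
        - 2 * ∑ t, πhat (X t, Y t, Z t) * rhat (Y t, Z t) + ∑ t, rhat (Y t, Z t) := by
    rw [Finset.mul_sum, ← Finset.sum_sub_distrib, ← Finset.sum_add_distrib]
    exact Finset.sum_congr rfl fun t _ => by ring
  rw [E, A', B']
  field_simp
  ring
end
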